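/- Every deterministic behavior of Kth order interference is classically realizable with K·2^{K−1} particles: for K ≥ 1, if f : {0,1}^N → {0,1} satisfies f̂(S) = 0 for every subset S ⊆ {1,…,N} with |S| > K (i.e., f has Fourier degree at most K), then f is a (K·2^{K−1})-junta. Consequently J_{N,K} ∩ D_N ⊆ C_{N, K·2^{K−1}}, where D_N denotes the set of {0,1}-valued functions on {0,1}^N. -/

import Mathlib

/-- `f` is a `K`-junta: there is a set `S` of at most `K` coordinates such that
`f x = f y` whenever `x` and `y` agree on all coordinates in `S`. -/
def IsJunta {α : Type*} (N K : ℕ) (f : (Fin N → Bool) → α) : Prop :=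
  ∃ S : Finset (Fin N), S.card ≤ K ∧
    ∀ x y : Fin N → Bool, (∀ i ∈ S, x i = y i) → f x = f y

/-- The Fourier coefficient `p̂(S) = 2^{−N} ∑_x (−1)^{∑_{i∈S} x_i} p(x)`. -/
noncomputable def bFourier {N : ℕ} (p : (Fin N → Bool) → ℝ) (S : Finset (Fin N)) : ℝ :=
  (∑ x : Fin N → Bool,
    (-1 : ℝ) ^ (S.filter (fun i => x i = true)).card * p x) / 2 ^ N

/-- The classical set `C_{N,K}`: convex combinations, over subsets `S` of (at most) `K`
coordinates, of `[0,1]`-valued functions depending only on the coordinates in `S`.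
(For `K ≤ N` this coincides with taking exactly `K`-element subsets; taking `card ≤ K`
keeps the definition meaningful also when `K > N`.) -/
def ClassicalSet (N K : ℕ) : Set ((Fin N → Bool) → ℝ) :=
  { p | ∃ (q : Finset (Fin N) → ℝ) (g : Finset (Fin N) → (Fin N → Bool) → ℝ),
      (∀ S, 0 ≤ q S) ∧
      (∑ S ∈ (Finset.univ : Finset (Fin N)).powerset.filter (fun S => S.card ≤ K), q S) = 1 ∧
      (∀ S ∈ (Finset.univ : Finset (Fin N)).powerset.filter (fun S => S.card ≤ K),
        (∀ x, g S x ∈ Set.Icc (0 : ℝ) 1) ∧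
        (∀ x y : Fin N → Bool, (∀ i ∈ S, x i = y i) → g S x = g S y)) ∧
      p = fun x => ∑ S ∈ (Finset.univ : Finset (Fin N)).powerset.filter
          (fun S => S.card ≤ K), q S * g S x }

open Finset

/-- The Walsh character `(−1)^{∑_{i∈S} x_i}`. -/
def walsh {ι : Type*} (S : Finset ι) (x : ι → Bool) : ℝ :=
  ∏ i ∈ S, if x i then (-1 : ℝ) else 1

/-- The Fourier coefficient of `p` at `S`, without the normalizing factor. -/
def walshSum {ι : Type*} [Fintype ι] [DecidableEq ι] (p : (ι → Bool) → ℝ) (S : Finset ι) : ℝ :=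
  ∑ x, walsh S x * p x

/-- Negation of the `i`th bit. -/
def flipBit {ι : Type*} [DecidableEq ι] (i : ι) (x : ι → Bool) : ι → Bool :=
  Function.update x i (!x i)

section Walsh

variable {ι : Type*}

theorem walsh_eq_neg_one_pow (S : Finset ι) (x : ι → Bool) :
    walsh S x = (-1 : ℝ) ^ (S.filter (fun i => x i = true)).card := by
  simp [walsh, Finset.prod_ite]

theorem sum_powerset_walsh_mul_walsh (T : Finset ι) (x z : ι → Bool) :
    ∑ U ∈ T.powerset, walsh U x * walsh U z =
      if ∀ i ∈ T, x i = z i then (2 : ℝ) ^ T.card else 0 := by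
  simp only [walsh, ← Finset.prod_mul_distrib]
  rw [← Finset.prod_one_add]
  split_ifs with h
  · rw [Finset.prod_congr rfl (g := fun _ => (2 : ℝ))]
    · simp
    · intro i hi
      rw [h i hi]
      cases z i <;> norm_num
  · push Not at h
    obtain ⟨i, hi, hne⟩ := h
    refine Finset.prod_eq_zero hi ?_
    cases hx : x i <;> cases hz : z i <;> simp_all

variable [DecidableEq ι]

theorem flipBit_involutive (i : ι) : Function.Involutive (flipBit i) := by
  intro x
  simp [flipBit]

theorem walsh_flipBit_of_mem {i : ι} {S : Finset ι} (hi : i ∈ S) (x : ι → Bool) :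
    walsh S (flipBit i x) = -walsh S x := by
  unfold walsh
  rw [← Finset.mul_prod_erase S _ hi, ← Finset.mul_prod_erase S (fun j => ite (x j) _ _) hi,
    Finset.prod_congr rfl (g := fun j => if x j then (-1 : ℝ) else 1)]
  · cases h : x i <;> simp [flipBit, h]
  · intro j hj
    simp [flipBit, Finset.ne_of_mem_erase hj]

theorem walsh_flipBit_of_notMem {i : ι} {S : Finset ι} (hi : i ∉ S) (x : ι → Bool) :
    walsh S (flipBit i x) = walsh S x := by
  refine Finset.prod_congr rfl fun j hj => ?_
  have : j ≠ i := fun h => hi (h ▸ hj)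
  simp [flipBit, this]

theorem walsh_union {S T : Finset ι} (h : Disjoint S T) (x : ι → Bool) :
    walsh (S ∪ T) x = walsh S x * walsh T x :=
  Finset.prod_union h

variable [Fintype ι]

theorem sum_flipBit (i : ι) (p : (ι → Bool) → ℝ) : ∑ x, p (flipBit i x) = ∑ x, p x :=
  Equiv.sum_comp (flipBit_involutive i).toPerm p

theorem walshSum_comp_flipBit_of_mem {i : ι} {S : Finset ι} (hi : i ∈ S) (p : (ι → Bool) → ℝ) :
    walshSum (fun x => p (flipBit i x)) S = -walshSum p S := by
  unfold walshSum
  rw [← sum_flipBit i, ← Finset.sum_neg_distrib]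
  simp [walsh_flipBit_of_mem hi, flipBit_involutive i _]

theorem walshSum_comp_flipBit_of_notMem {i : ι} {S : Finset ι} (hi : i ∉ S)
    (p : (ι → Bool) → ℝ) : walshSum (fun x => p (flipBit i x)) S = walshSum p S := by
  unfold walshSum
  rw [← sum_flipBit i]
  simp [walsh_flipBit_of_notMem hi, flipBit_involutive i _]

theorem walshSum_sub (p q : (ι → Bool) → ℝ) (S : Finset ι) :
    walshSum (fun x => p x - q x) S = walshSum p S - walshSum q S := by
  simp [walshSum, mul_sub]

/-- Parseval's identity. -/
theorem sum_walshSum_sq (p : (ι → Bool) → ℝ) :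
    ∑ S, walshSum p S ^ 2 = 2 ^ Fintype.card ι * ∑ x, p x ^ 2 := by
  have key (x z : ι → Bool) : ∑ U : Finset ι, walsh U x * walsh U z =
      if x = z then (2 : ℝ) ^ Fintype.card ι else 0 := by
    have := sum_powerset_walsh_mul_walsh univ x z
    simpa [funext_iff] using this
  calc ∑ S, walshSum p S ^ 2
      = ∑ S, ∑ x, ∑ z, p x * p z * (walsh S x * walsh S z) := by
        refine Finset.sum_congr rfl fun S _ => ?_
        rw [sq, walshSum, Finset.sum_mul_sum]
        exact Finset.sum_congr rfl fun x _ => Finset.sum_congr rfl fun z _ => by ring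
    _ = ∑ x, ∑ z, p x * p z * ∑ S, walsh S x * walsh S z := by
        rw [Finset.sum_comm]
        refine Finset.sum_congr rfl fun x _ => ?_
        rw [Finset.sum_comm]
        simp [Finset.mul_sum]
    _ = 2 ^ Fintype.card ι * ∑ x, p x ^ 2 := by
        simp only [key, mul_ite, mul_zero, Finset.sum_ite_eq, Finset.mem_univ, if_true,
          Finset.mul_sum]
        exact Finset.sum_congr rfl fun x _ => by ring

/-- If `S` is maximal in the Fourier support of `p`, then the restrictions of `p` to the subcubes
in the directions of `S` all have the same nonzero top coefficient. -/
theorem sum_subcube_walsh_mul {S : Finset ι} {p : (ι → Bool) → ℝ}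
    (hmax : ∀ T, S ⊂ T → walshSum p T = 0) (z : ι → Bool) :
    2 ^ Sᶜ.card * ∑ x with ∀ i ∈ Sᶜ, x i = z i, walsh S x * p x = walshSum p S := by
  calc 2 ^ Sᶜ.card * ∑ x with ∀ i ∈ Sᶜ, x i = z i, walsh S x * p x
      = ∑ x, (∑ U ∈ Sᶜ.powerset, walsh U x * walsh U z) * (walsh S x * p x) := by
        simp only [sum_powerset_walsh_mul_walsh, Finset.sum_filter, Finset.mul_sum]
        exact Finset.sum_congr rfl fun x _ => by split_ifs <;> simp
    _ = ∑ U ∈ Sᶜ.powerset, walsh U z * walshSum p (S ∪ U) := by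
        simp only [Finset.sum_mul]
        rw [Finset.sum_comm]
        refine Finset.sum_congr rfl fun U hU => ?_
        rw [walshSum, Finset.mul_sum]
        refine Finset.sum_congr rfl fun x _ => ?_
        rw [walsh_union (disjoint_compl_right.mono_right (Finset.mem_powerset.1 hU))]
        ring
    _ = walshSum p S := by
        rw [Finset.sum_eq_single ∅]
        · simp [walsh]
        · intro U hU hne
          rw [hmax, mul_zero]
          obtain ⟨i, hi⟩ := Finset.nonempty_iff_ne_empty.2 hne
          have hiS : i ∉ S := Finset.mem_compl.1 (Finset.mem_powerset.1 hU hi)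
          exact Finset.ssubset_iff_subset_ne.2 ⟨Finset.subset_union_left,
            fun h => hiS (h ▸ Finset.mem_union_right S hi)⟩
        · simp

theorem card_subcube (S : Finset ι) (x : ι → Bool) :
    #{z : ι → Bool | ∀ i ∈ Sᶜ, x i = z i} = 2 ^ S.card := by
  have : ({z : ι → Bool | ∀ i ∈ Sᶜ, x i = z i} : Finset (ι → Bool)) =
      Fintype.piFinset fun i => if i ∈ S then univ else {x i} := by
    ext z
    simp only [Finset.mem_filter, Finset.mem_univ, true_and, Finset.mem_compl,
      Fintype.mem_piFinset]
    refine forall_congr' fun i => ?_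
    by_cases hi : i ∈ S
    · simp [hi]
    · simp [hi, eq_comm (a := x i)]
  rw [this, Fintype.card_piFinset]
  simp [apply_ite Finset.card]

/-- The inputs at which `p` is sensitive to the `i`th bit. -/
noncomputable def sensitiveAt (p : (ι → Bool) → ℝ) (i : ι) : Finset (ι → Bool) :=
  {x | p x ≠ p (flipBit i x)}

/-- Each subcube in the directions of a maximal `S ∋ i` contains two inputs sensitive to `i`. -/
theorem two_le_card_sensitiveAt_subcube {S : Finset ι} {p : (ι → Bool) → ℝ} {i : ι} (hi : i ∈ S)
    (hmax : ∀ T, S ⊂ T → walshSum p T = 0) (hS : walshSum p S ≠ 0) (z : ι → Bool) :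
    2 ≤ #{x ∈ sensitiveAt p i | ∀ j ∈ Sᶜ, x j = z j} := by
  have flip_mem (x : ι → Bool) (hx : ∀ j ∈ Sᶜ, x j = z j) :
      ∀ j ∈ Sᶜ, flipBit i x j = z j := by
    intro j hj
    have : j ≠ i := fun h => Finset.mem_compl.1 hj (h ▸ hi)
    simpa [flipBit, this] using hx j hj
  obtain ⟨x, hx, hne⟩ : ∃ x : ι → Bool, (∀ j ∈ Sᶜ, x j = z j) ∧ p x ≠ p (flipBit i x) := by
    by_contra! h
    refine hS ?_
    rw [← sum_subcube_walsh_mul hmax z, mul_eq_zero]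
    right
    refine Finset.sum_involution (fun x _ => flipBit i x) ?_ ?_ ?_ ?_
    · intro x hx
      rw [walsh_flipBit_of_mem hi, ← h x (Finset.mem_filter.1 hx).2]
      ring
    · intro x _ _ heq
      simpa [flipBit] using congrFun heq i
    · intro x hx
      exact Finset.mem_filter.2 ⟨Finset.mem_univ _, flip_mem x (Finset.mem_filter.1 hx).2⟩
    · intro x _
      exact flipBit_involutive i x
  refine Finset.one_lt_card.2 ⟨x, ?_, flipBit i x, ?_, fun heq => hne (congrArg p heq)⟩
  · simp only [sensitiveAt, Finset.mem_filter, Finset.mem_univ, true_and]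
    exact ⟨hne, hx⟩
  · simp only [sensitiveAt, Finset.mem_filter, Finset.mem_univ, true_and]
    rw [flipBit_involutive i x]
    exact ⟨hne.symm, flip_mem x hx⟩

theorem sum_walshSum_sq_sub_flipBit (p : (ι → Bool) → ℝ) (i : ι) :
    2 ^ Fintype.card ι * ∑ x, (p x - p (flipBit i x)) ^ 2 =
      4 * ∑ S with i ∈ S, walshSum p S ^ 2 := by
  rw [← sum_walshSum_sq, Finset.sum_filter, Finset.mul_sum]
  refine Finset.sum_congr rfl fun S _ => ?_
  rw [walshSum_sub p]
  split_ifs with hi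
  · rw [walshSum_comp_flipBit_of_mem hi]
    ring
  · rw [walshSum_comp_flipBit_of_notMem hi]
    ring

theorem two_pow_le_card_sensitiveAt {K : ℕ} {p : (ι → Bool) → ℝ}
    (hp : ∀ S : Finset ι, K < S.card → walshSum p S = 0) {i : ι}
    (hi : (sensitiveAt p i).Nonempty) :
    2 * 2 ^ Fintype.card ι ≤ (sensitiveAt p i).card * 2 ^ K := by
  obtain ⟨S₀, hS₀⟩ : ∃ S : Finset ι, i ∈ S ∧ walshSum p S ≠ 0 := by
    by_contra! h
    have h0 := sum_walshSum_sq_sub_flipBit p i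
    rw [Finset.sum_eq_zero (s := univ.filter fun S => i ∈ S)
      (fun S hS => by rw [h S (Finset.mem_filter.1 hS).2]; norm_num)] at h0
    obtain ⟨x, hx⟩ := hi
    have h1 : ∑ x, (p x - p (flipBit i x)) ^ 2 = 0 := by simpa using h0
    have h2 := (Finset.sum_eq_zero_iff_of_nonneg fun x _ => sq_nonneg _).1 h1 x
      (Finset.mem_univ x)
    refine (Finset.mem_filter.1 hx).2 ?_
    exact sub_eq_zero.1 (pow_eq_zero_iff two_ne_zero |>.1 h2)
  obtain ⟨S, ⟨hiS, hS⟩, hmax⟩ :=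
    (Set.toFinite {S : Finset ι | i ∈ S ∧ walshSum p S ≠ 0}).exists_maximal ⟨S₀, hS₀⟩
  have hmax' (T : Finset ι) (hT : S ⊂ T) : walshSum p T = 0 := by
    by_contra h
    exact hT.2 (hmax ⟨hT.1 hiS, h⟩ hT.1)
  have hSK : S.card ≤ K := by
    by_contra! h
    exact hS (hp S h)
  calc 2 * 2 ^ Fintype.card ι
      = ∑ z : ι → Bool, 2 := by simp [mul_comm]
    _ ≤ ∑ z : ι → Bool, #{x ∈ sensitiveAt p i | ∀ j ∈ Sᶜ, x j = z j} :=
        Finset.sum_le_sum fun z _ => two_le_card_sensitiveAt_subcube hiS hmax' hS z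
    _ = ∑ x ∈ sensitiveAt p i, #{z : ι → Bool | ∀ j ∈ Sᶜ, x j = z j} :=
        (Finset.sum_card_bipartiteAbove_eq_sum_card_bipartiteBelow
          (s := sensitiveAt p i) (t := univ)
          (fun (x z : ι → Bool) => ∀ j ∈ Sᶜ, x j = z j)).symm
    _ = (sensitiveAt p i).card * 2 ^ S.card := by
        simp only [card_subcube, Finset.sum_const, smul_eq_mul]
    _ ≤ (sensitiveAt p i).card * 2 ^ K := by gcongr; norm_num

/-- The total sensitivity of a sign-valued function of degree at most `K`. -/
theorem sum_card_sensitiveAt_le {K : ℕ} {p : (ι → Bool) → ℝ}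
    (hp : ∀ S : Finset ι, K < S.card → walshSum p S = 0) (hsign : ∀ x, p x = 1 ∨ p x = -1) :
    ∑ i, (sensitiveAt p i).card ≤ K * 2 ^ Fintype.card ι := by
  have hcard (i : ι) : (2 : ℝ) ^ Fintype.card ι * (sensitiveAt p i).card =
      ∑ S with i ∈ S, walshSum p S ^ 2 := by
    have hsum : ∑ x, (p x - p (flipBit i x)) ^ 2 = 4 * ((sensitiveAt p i).card : ℝ) := by
      rw [sensitiveAt, Finset.card_filter, Nat.cast_sum, Finset.mul_sum]
      refine Finset.sum_congr rfl fun x _ => ?_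
      rcases hsign x with h | h <;> rcases hsign (flipBit i x) with h' | h' <;>
        rw [h, h'] <;> norm_num
    have := sum_walshSum_sq_sub_flipBit p i
    rw [hsum] at this
    linarith
  have htotal : ∑ S, walshSum p S ^ 2 = (2 : ℝ) ^ Fintype.card ι * 2 ^ Fintype.card ι := by
    rw [sum_walshSum_sq, Finset.sum_congr rfl (g := fun _ => (1 : ℝ))]
    · simp
    · intro x _
      rcases hsign x with h | h <;> rw [h] <;> norm_num
  have hswap : (2 : ℝ) ^ Fintype.card ι * ∑ i, ((sensitiveAt p i).card : ℝ) =
      ∑ S : Finset ι, S.card * walshSum p S ^ 2 := by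
    rw [Finset.mul_sum]
    simp only [hcard, Finset.sum_filter]
    rw [Finset.sum_comm]
    refine Finset.sum_congr rfl fun S _ => ?_
    simp
  have hle : ∑ S : Finset ι, S.card * walshSum p S ^ 2 ≤ K * ∑ S, walshSum p S ^ 2 := by
    rw [Finset.mul_sum]
    refine Finset.sum_le_sum fun S _ => ?_
    rcases le_or_gt S.card K with h | h
    · gcongr
    · simp [hp S h]
  rw [← hswap, htotal, mul_left_comm] at hle
  exact_mod_cast le_of_mul_le_mul_left hle (by positivity)

/-- The Nisan–Szegedy bound on the number of relevant variables. -/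
theorem card_relevant_le {K : ℕ} (hK : 1 ≤ K) {p : (ι → Bool) → ℝ}
    (hp : ∀ S : Finset ι, K < S.card → walshSum p S = 0) (hsign : ∀ x, p x = 1 ∨ p x = -1) :
    #{i | (sensitiveAt p i).Nonempty} ≤ K * 2 ^ (K - 1) := by
  obtain ⟨k, rfl⟩ := Nat.exists_eq_add_of_le' hK
  have h : #{i | (sensitiveAt p i).Nonempty} * (2 * 2 ^ Fintype.card ι) ≤
      (k + 1) * 2 ^ k * (2 * 2 ^ Fintype.card ι) :=
    calc #{i | (sensitiveAt p i).Nonempty} * (2 * 2 ^ Fintype.card ι)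
        ≤ ∑ i with (sensitiveAt p i).Nonempty, (sensitiveAt p i).card * 2 ^ (k + 1) := by
          rw [← smul_eq_mul]
          exact Finset.card_nsmul_le_sum _ _ _ fun i hi =>
            two_pow_le_card_sensitiveAt hp (Finset.mem_filter.1 hi).2
      _ ≤ ∑ i, (sensitiveAt p i).card * 2 ^ (k + 1) :=
          Finset.sum_le_sum_of_subset (Finset.filter_subset _ _)
      _ ≤ (k + 1) * 2 ^ Fintype.card ι * 2 ^ (k + 1) := by
          rw [← Finset.sum_mul]
          exact Nat.mul_le_mul_right _ (sum_card_sensitiveAt_le hp hsign)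
      _ = (k + 1) * 2 ^ k * (2 * 2 ^ Fintype.card ι) := by ring
  simpa using Nat.le_of_mul_le_mul_right h (by positivity)

theorem eq_of_forall_relevant_eq (p : (ι → Bool) → ℝ) {x y : ι → Bool}
    (hxy : ∀ i ∈ ({i | (sensitiveAt p i).Nonempty} : Finset ι), x i = y i) : p x = p y := by
  have hT (T : Finset ι) : p (T.piecewise y x) = p x := by
    induction T using Finset.induction_on with
    | empty => simp
    | insert a T _ ih =>
      rw [Finset.piecewise_insert, ← ih]
      set w := T.piecewise y x with hw
      by_cases hwa : w a = y a
      · rw [← hwa, Function.update_eq_self]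
      · have hxa : x a ≠ y a := by
          intro h
          by_cases haT : a ∈ T <;> simp_all
        have hins : p w = p (flipBit a w) := by
          by_contra h
          exact hxa (hxy a (by simpa using ⟨w, by simpa [sensitiveAt] using h⟩))
        have hya : y a = !w a := by cases h : y a <;> cases h' : w a <;> simp_all
        rw [hya]
        exact hins.symm
  have := hT univ
  rw [Finset.piecewise_univ] at this
  exact this.symm

theorem walshSum_one {S : Finset ι} (hS : S.Nonempty) : walshSum (fun _ => 1) S = 0 := by
  obtain ⟨i, hi⟩ := hS
  have := walshSum_comp_flipBit_of_mem hi (fun _ => 1)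
  linarith

end Walsh

theorem IsJunta.mem_classicalSet {N K : ℕ} {f : (Fin N → Bool) → Bool} (hf : IsJunta N K f) :
    (fun x => if f x then (1 : ℝ) else 0) ∈ ClassicalSet N K := by
  obtain ⟨R, hR, hfR⟩ := hf
  refine ⟨fun S => if S = R then 1 else 0,
    fun S x => if S = R then (if f x then 1 else 0) else 0, ?_, ?_, ?_, ?_⟩
  · intro S
    dsimp only
    split_ifs <;> norm_num
  · simp [hR]
  · intro S _
    by_cases h : S = R
    · subst h
      refine ⟨fun x => ?_, fun x y hxy => by simp [hfR x y hxy]⟩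
      cases hx : f x <;> simp [hx]
    · simp [h]
  · funext x
    simp [hR]

/-- for `K ≥ 1`, if `f : {0,1}^N → {0,1}` has Fourier degree at most `K`
(i.e. `f̂(S) = 0` whenever `|S| > K`), then `f` is a `K·2^{K−1}`-junta; consequently the
corresponding deterministic behavior lies in `C_{N, K·2^{K−1}}`, i.e.
`J_{N,K} ∩ D_N ⊆ C_{N, K·2^{K−1}}`. -/
theorem stmt6 (N K : ℕ) (hK : 1 ≤ K) (f : (Fin N → Bool) → Bool)
    (hf : ∀ S : Finset (Fin N), K < S.card →
      bFourier (fun x => if f x then (1 : ℝ) else 0) S = 0) :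
    IsJunta N (K * 2 ^ (K - 1)) f ∧
    (fun x => if f x then (1 : ℝ) else 0) ∈ ClassicalSet N (K * 2 ^ (K - 1)) := by
  suffices h : IsJunta N (K * 2 ^ (K - 1)) f from ⟨h, h.mem_classicalSet⟩
  set p : (Fin N → Bool) → ℝ :=
    fun x => 1 - ((if f x then (1 : ℝ) else 0) + if f x then (1 : ℝ) else 0) with hpdef
  have hp (S : Finset (Fin N)) (hS : K < S.card) : walshSum p S = 0 := by
    have h0 : walshSum (fun x => if f x then (1 : ℝ) else 0) S = 0 := by
      simpa only [walshSum, bFourier, ← walsh_eq_neg_one_pow, div_eq_zero_iff, pow_eq_zero_iff',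
        OfNat.ofNat_ne_zero, ne_eq, false_and, or_false] using hf S hS
    have h1 := walshSum_one (Finset.card_pos.1 (Nat.zero_lt_of_lt hS))
    have h2 : walshSum p S = walshSum (fun _ => 1) S -
        (walshSum (fun x => if f x then (1 : ℝ) else 0) S +
          walshSum (fun x => if f x then (1 : ℝ) else 0) S) := by
      simp only [hpdef, walshSum, mul_sub, mul_add, Finset.sum_sub_distrib, Finset.sum_add_distrib]
    rw [h2, h1, h0]
    norm_num
  have hsign (x : Fin N → Bool) : p x = 1 ∨ p x = -1 := by
    cases hx : f x <;> norm_num [hpdef, hx]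
  refine ⟨_, card_relevant_le hK hp hsign, fun x y hxy => ?_⟩
  have := eq_of_forall_relevant_eq p hxy
  cases hx : f x <;> cases hy : f y
  · rfl
  · norm_num [hpdef, hx, hy] at this
  · norm_num [hpdef, hx, hy] at this
  · rfl
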